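/- (Corollary, case h = 2/q) As q → ∞ through odd integers q = 2ν+1 (ν = 2, 3, …), with h = 2/q one has A(h) = h + (π²/16)h³ + (5π⁴/768)h⁵ + O(h⁷). -/

import Mathlib

open Real Asymptotics Filter

/-- Membership in the Turán class `K(h)`, encoded via the nonnegative Fourier cosine
coefficient sequence `a` of a continuous 1-periodic even function
`f(x) = ∑' n, a n * cos (2πnx)`: all `a n ≥ 0`, `∑ a n = 1` (so `f 0 = 1`), and
`f x = 0` for `h ≤ |x| ≤ 1/2`. -/
def memK (h : ℝ) (a : ℕ → ℝ) : Prop :=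
  (∀ n, 0 ≤ a n) ∧ Summable a ∧ (∑' n, a n) = 1 ∧
    ∀ x : ℝ, h ≤ |x| → |x| ≤ 1 / 2 → (∑' n : ℕ, a n * Real.cos (2 * π * n * x)) = 0

/-- The Turán constant `A(h) = sup_{f ∈ K(h)} a₀`. -/
noncomputable def turanA (h : ℝ) : ℝ :=
  sSup {y : ℝ | ∃ a : ℕ → ℝ, memK h a ∧ y = a 0}

/-- The Dirichlet kernel `∑_{|k| ≤ ν} cos (k t)`. -/
noncomputable def dirichletCos (ν : ℕ) (t : ℝ) : ℝ :=
  1 + 2 * ∑ k ∈ Finset.range ν, cos (((k : ℝ) + 1) * t)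

lemma sin_half_mul_dirichletCos (ν : ℕ) (t : ℝ) :
    sin (t / 2) * dirichletCos ν t = sin ((2 * (ν : ℝ) + 1) * (t / 2)) := by
  induction ν with
  | zero => simp [dirichletCos]
  | succ m ih =>
    have h : dirichletCos (m + 1) t = dirichletCos m t + 2 * cos (((m : ℝ) + 1) * t) := by
      simp only [dirichletCos, Finset.sum_range_succ]
      ring
    rw [h, mul_add, ih]
    have e1 : (2 * (m : ℝ) + 1) * (t / 2) = ((m : ℝ) + 1) * t - t / 2 := by ring
    have e2 : (2 * ((m + 1 : ℕ) : ℝ) + 1) * (t / 2) = ((m : ℝ) + 1) * t + t / 2 := by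
      push_cast
      ring
    rw [e1, e2, sin_sub, sin_add]
    ring

lemma dirichletCos_zero (ν : ℕ) : dirichletCos ν 0 = 2 * (ν : ℝ) + 1 := by
  simp [dirichletCos]
  ring

lemma dirichletCos_nonneg (ν : ℕ) (m : ℤ) :
    0 ≤ dirichletCos ν (2 * π * m / (2 * (ν : ℝ) + 1)) := by
  set t : ℝ := 2 * π * m / (2 * (ν : ℝ) + 1) with ht
  have hq : (2 * (ν : ℝ) + 1) ≠ 0 := by positivity
  have h := sin_half_mul_dirichletCos ν t
  have h0 : sin ((2 * (ν : ℝ) + 1) * (t / 2)) = 0 := by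
    rw [show (2 * (ν : ℝ) + 1) * (t / 2) = m * π by rw [ht]; field_simp]
    exact sin_int_mul_pi m
  rw [h0] at h
  rcases mul_eq_zero.mp h with h1 | h1
  · obtain ⟨l, hl⟩ := sin_eq_zero_iff.mp h1
    have hk : ∀ k ∈ Finset.range ν, 0 ≤ cos (((k : ℝ) + 1) * t) := by
      intro k _
      have : ((k : ℝ) + 1) * t = ((((k : ℤ) + 1) * l : ℤ) : ℝ) * (2 * π) := by
        push_cast
        linear_combination -2 * ((k : ℝ) + 1) * hl
      rw [this, cos_int_mul_two_pi]
      exact zero_le_one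
    have := Finset.sum_nonneg hk
    unfold dirichletCos
    linarith
  · exact h1.ge

lemma dirichletCos_add_sub (ν : ℕ) (t s : ℝ) :
    (dirichletCos ν (t + s) + dirichletCos ν (t - s)) / 2 =
      1 + 2 * ∑ k ∈ Finset.range ν, cos (((k : ℝ) + 1) * s) * cos (((k : ℝ) + 1) * t) := by
  have : ∑ k ∈ Finset.range ν, cos (((k : ℝ) + 1) * s) * cos (((k : ℝ) + 1) * t) =
      (∑ k ∈ Finset.range ν, cos (((k : ℝ) + 1) * (t + s)) +
        ∑ k ∈ Finset.range ν, cos (((k : ℝ) + 1) * (t - s))) / 2 := by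
    rw [← Finset.sum_add_distrib, Finset.sum_div]
    refine Finset.sum_congr rfl fun k _ => ?_
    rw [mul_add, mul_sub, cos_add, cos_sub]
    ring
  rw [this]
  unfold dirichletCos
  ring

lemma Summable.mul_cos {a : ℕ → ℝ} (ha : ∀ n, 0 ≤ a n) (hs : Summable a) (b : ℕ → ℝ) :
    Summable fun n => a n * cos (b n) := by
  refine Summable.of_norm_bounded hs fun n => ?_
  rw [norm_mul, norm_of_nonneg (ha n)]
  exact mul_le_of_le_one_right (ha n) (abs_cos_le_one _)

lemma mul_dirichletCos_le_of_memK {ν : ℕ} (hν : 1 ≤ ν) {a : ℕ → ℝ}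
    (h : memK (2 / (2 * (ν : ℝ) + 1)) a) (j : ℤ) :
    a 0 * dirichletCos ν (2 * π * j / (2 * (ν : ℝ) + 1)) ≤
      1 + 2 * (cos (2 * π * j / (2 * (ν : ℝ) + 1)) *
        ∑' n : ℕ, a n * cos (2 * π * n * (1 / (2 * (ν : ℝ) + 1)))) := by
  obtain ⟨ha, hs, h1, hz⟩ := h
  set q : ℝ := 2 * (ν : ℝ) + 1 with hq
  have hq0 : 0 < q := by positivity
  set s : ℝ := 2 * π * j / q with hsdef
  set F : ℝ → ℝ := fun x => ∑' n : ℕ, a n * cos (2 * π * n * x) with hF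
  have hFs : ∀ x, HasSum (fun n : ℕ => a n * cos (2 * π * n * x)) (F x) := fun x =>
    (Summable.mul_cos ha hs fun n => 2 * π * n * x).hasSum
  have hsum : HasSum (fun n : ℕ => a n * ((dirichletCos ν (2 * π * n / q + s) +
      dirichletCos ν (2 * π * n / q - s)) / 2))
      (1 + 2 * ∑ k ∈ Finset.range ν, cos (((k : ℝ) + 1) * s) * F (((k : ℝ) + 1) / q)) := by
    have := (h1 ▸ hs.hasSum).add ((hasSum_sum (s := Finset.range ν) fun k _ =>
      (hFs (((k : ℝ) + 1) / q)).mul_left (cos (((k : ℝ) + 1) * s))).mul_left 2)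
    refine this.congr_fun ?_
    intro n
    rw [dirichletCos_add_sub, mul_add, mul_one, mul_left_comm, Finset.mul_sum]
    congr 2
    refine Finset.sum_congr rfl fun k _ => ?_
    rw [show ((k : ℝ) + 1) * (2 * π * n / q) = 2 * π * n * (((k : ℝ) + 1) / q) by ring]
    ring
  have hval : ∑ k ∈ Finset.range ν, cos (((k : ℝ) + 1) * s) * F (((k : ℝ) + 1) / q) =
      cos s * F (1 / q) := by
    rw [Finset.sum_eq_single_of_mem 0 (Finset.mem_range.mpr hν)]
    · simp
    · intro k hk hk0
      have hk' : (k : ℝ) + 1 ≤ ν := by exact_mod_cast Finset.mem_range.mp hk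
      have hk1 : (1 : ℝ) ≤ k := by exact_mod_cast Nat.one_le_iff_ne_zero.mpr hk0
      have habs : |((k : ℝ) + 1) / q| = ((k : ℝ) + 1) / q := abs_of_nonneg (by positivity)
      have : F (((k : ℝ) + 1) / q) = 0 := by
        apply hz
        · rw [habs]
          gcongr
          linarith
        · rw [habs, div_le_iff₀ hq0]
          linarith
      rw [this, mul_zero]
  rw [hval] at hsum
  have hnn : ∀ n : ℕ, 0 ≤ a n * ((dirichletCos ν (2 * π * n / q + s) +
      dirichletCos ν (2 * π * n / q - s)) / 2) := by
    intro n
    have e1 : 2 * π * n / q + s = 2 * π * ((n + j : ℤ) : ℝ) / q := by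
      rw [hsdef]
      push_cast
      ring
    have e2 : 2 * π * n / q - s = 2 * π * ((n - j : ℤ) : ℝ) / q := by
      rw [hsdef]
      push_cast
      ring
    have h1 := dirichletCos_nonneg ν (n + j)
    have h2 := dirichletCos_nonneg ν (n - j)
    rw [e1, e2]
    exact mul_nonneg (ha n) (by linarith)
  have hle := le_hasSum hsum 0 fun n _ => hnn n
  have heven : dirichletCos ν (-s) = dirichletCos ν s := by simp [dirichletCos]
  simpa [heven] using hle

lemma cos_two_pi_mul_div_odd (ν : ℕ) :
    cos (2 * π * ν / (2 * (ν : ℝ) + 1)) = -cos (π / (2 * (ν : ℝ) + 1)) := by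
  rw [← cos_pi_sub]
  congr 1
  field_simp
  ring

lemma cos_pi_div_pos {ν : ℕ} (hν : 1 ≤ ν) : 0 < cos (π / (2 * (ν : ℝ) + 1)) := by
  have hν' : (1 : ℝ) ≤ ν := by exact_mod_cast hν
  have h0 : 0 < π / (2 * (ν : ℝ) + 1) := by positivity
  refine cos_pos_of_mem_Ioo ⟨by linarith [pi_pos], ?_⟩
  gcongr
  linarith

lemma coeff_zero_le_of_memK {ν : ℕ} (hν : 1 ≤ ν) {a : ℕ → ℝ}
    (h : memK (2 / (2 * (ν : ℝ) + 1)) a) :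
    a 0 ≤ (1 + 1 / cos (π / (2 * (ν : ℝ) + 1))) / (2 * (ν : ℝ) + 1) := by
  have hc := cos_pi_div_pos hν
  have h0 := mul_dirichletCos_le_of_memK hν h 0
  have h1 := mul_dirichletCos_le_of_memK hν h ν
  have h2 := mul_nonneg (h.1 0) (dirichletCos_nonneg ν ν)
  rw [Int.cast_natCast] at h1 h2
  rw [cos_two_pi_mul_div_odd] at h1
  simp only [Int.cast_zero, mul_zero, zero_div, dirichletCos_zero, cos_zero, one_mul] at h0
  set F := ∑' n : ℕ, a n * cos (2 * π * n * (1 / (2 * (ν : ℝ) + 1)))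
  rw [le_div_iff₀ (by positivity)]
  have : 2 * F ≤ 1 / cos (π / (2 * (ν : ℝ) + 1)) := by
    rw [le_div_iff₀ hc]
    linarith
  linarith

lemma neg_cos_pi_div_le_cos (ν n : ℕ) :
    -cos (π / (2 * (ν : ℝ) + 1)) ≤ cos (2 * π * n / (2 * (ν : ℝ) + 1)) := by
  set q : ℝ := 2 * (ν : ℝ) + 1 with hq
  have hq0 : 0 < q := by positivity
  have key : ∀ r : ℕ, r ≤ ν → -cos (π / q) ≤ cos (2 * π * r / q) := by
    intro r hr
    have hr' : (r : ℝ) ≤ ν := by exact_mod_cast hr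
    rw [← cos_two_pi_mul_div_odd]
    refine cos_le_cos_of_nonneg_of_le_pi (by positivity) ?_ (by gcongr)
    rw [div_le_iff₀ hq0]
    nlinarith [pi_pos]
  have hdiv : ((2 * ν + 1 : ℕ) : ℝ) * ((n / (2 * ν + 1) : ℕ) : ℝ) +
      ((n % (2 * ν + 1) : ℕ) : ℝ) = n := by exact_mod_cast Nat.div_add_mod n (2 * ν + 1)
  have hlt : n % (2 * ν + 1) < 2 * ν + 1 := Nat.mod_lt _ (by omega)
  set r := n % (2 * ν + 1)
  set d := n / (2 * ν + 1)
  push_cast at hdiv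
  have hper : cos (2 * π * n / q) = cos (2 * π * r / q) := by
    rw [← hdiv, show 2 * π * ((2 * (ν : ℝ) + 1) * d + r) / q = 2 * π * r / q + d * (2 * π) by
      rw [← hq]; field_simp; ring]
    exact cos_add_nat_mul_two_pi _ _
  rw [hper]
  rcases le_or_gt r ν with h | h
  · exact key r h
  · have := key (2 * ν + 1 - r) (by omega)
    rwa [Nat.cast_sub hlt.le, show 2 * π * (((2 * ν + 1 : ℕ) : ℝ) - r) / q =
      2 * π - 2 * π * r / q by push_cast; rw [← hq]; field_simp, cos_two_pi_sub] at this

lemma hasSum_cos_div_sq {x : ℝ} (h0 : 0 ≤ x) (h1 : x ≤ 1) :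
    HasSum (fun n : ℕ => 1 / (n : ℝ) ^ 2 * cos (2 * π * n * x)) (π ^ 2 * (x ^ 2 - x + 1 / 6)) := by
  have := hasSum_one_div_nat_pow_mul_cos one_ne_zero ⟨h0, h1⟩
  rw [show (Polynomial.map (algebraMap ℚ ℝ) (Polynomial.bernoulli (2 * 1))).eval x =
    x ^ 2 - x + 6⁻¹ from bernoulliFun_two x] at this
  convert! this using 1
  simp only [mul_one, Nat.factorial]
  push_cast
  ring

/-- The coefficients of the extremal function, which is piecewise linear. -/
noncomputable def extremalCoeff (ν : ℕ) (n : ℕ) : ℝ :=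
  (if n = 0 then (1 + 1 / cos (π / (2 * (ν : ℝ) + 1))) / (2 * (ν : ℝ) + 1) else 0) +
    2 * (2 * (ν : ℝ) + 1) / (π ^ 2 * cos (π / (2 * (ν : ℝ) + 1))) * (1 / (n : ℝ) ^ 2 *
      (sin (π * n / (2 * (ν : ℝ) + 1)) ^ 2 *
        (cos (2 * π * n / (2 * (ν : ℝ) + 1)) + cos (π / (2 * (ν : ℝ) + 1)))))

lemma extremalCoeff_zero (ν : ℕ) : extremalCoeff ν 0 =
    (1 + 1 / cos (π / (2 * (ν : ℝ) + 1))) / (2 * (ν : ℝ) + 1) := by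
  simp [extremalCoeff]

lemma sin_sq_mul_cos_add (t c : ℝ) : sin (t / 2) ^ 2 * (cos t + c) =
    1 / 2 * (c - 1 / 2 + (1 - c) * cos t - 1 / 2 * cos (2 * t)) := by
  rw [sin_sq_eq_half_sub, mul_div_cancel₀ t two_ne_zero, cos_two_mul]
  ring

lemma hasSum_extremalCoeff {ν : ℕ} (hν : 1 ≤ ν) : HasSum (extremalCoeff ν) 1 := by
  have hc := (cos_pi_div_pos hν).ne'
  have hν' : (1 : ℝ) ≤ ν := by exact_mod_cast hν
  unfold extremalCoeff
  set q : ℝ := 2 * (ν : ℝ) + 1 with hq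
  have hq0 : 0 < q := by positivity
  set c := cos (π / q)
  have g0 := hasSum_cos_div_sq le_rfl zero_le_one
  have g1 := hasSum_cos_div_sq (x := 1 / q) (by positivity)
    (by rw [div_le_one hq0]; linarith)
  have g2 := hasSum_cos_div_sq (x := 2 / q) (by positivity)
    (by rw [div_le_one hq0]; linarith)
  have := (hasSum_ite_eq (0 : ℕ) ((1 + 1 / c) / q)).add
    ((((g0.mul_left (c - 1 / 2)).add (g1.mul_left (1 - c))).sub
      (g2.mul_left (1 / 2))).mul_left (2 * q / (π ^ 2 * c) * (1 / 2)))
  convert! this using 1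
  · ext n
    rw [show π * n / q = 2 * π * n / q / 2 by ring, sin_sq_mul_cos_add,
      show 2 * π * n * (1 / q) = 2 * π * n / q by ring,
      show 2 * π * n * (2 / q) = 2 * (2 * π * n / q) by ring, mul_zero, cos_zero]
    ring
  · field_simp
    ring

lemma hasSum_extremalCoeff_mul_cos {ν : ℕ} (hν : 2 ≤ ν) {x : ℝ}
    (hx : 2 / (2 * (ν : ℝ) + 1) ≤ x) (hx' : x ≤ 1 / 2) :
    HasSum (fun n : ℕ => extremalCoeff ν n * cos (2 * π * n * x)) 0 := by
  have hc := (cos_pi_div_pos (by omega : 1 ≤ ν)).ne'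
  have hν' : (2 : ℝ) ≤ ν := by exact_mod_cast hν
  unfold extremalCoeff
  set q : ℝ := 2 * (ν : ℝ) + 1 with hq
  have hq0 : 0 < q := by positivity
  set c := cos (π / q)
  have h2 : 2 / q ≤ 1 / 2 := hx.trans hx'
  have h12 : 1 / q ≤ 2 / q := by gcongr; norm_num
  have h01 : 0 < 1 / q := by positivity
  have g0 := hasSum_cos_div_sq (x := x) (by linarith) (by linarith)
  have g1 := hasSum_cos_div_sq (x := x + 1 / q) (by linarith) (by linarith)
  have g1' := hasSum_cos_div_sq (x := x - 1 / q) (by linarith) (by linarith)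
  have g2 := hasSum_cos_div_sq (x := x + 2 / q) (by linarith) (by linarith)
  have g2' := hasSum_cos_div_sq (x := x - 2 / q) (by linarith) (by linarith)
  have := (hasSum_ite_eq (0 : ℕ) ((1 + 1 / c) / q)).add
    ((((g0.mul_left (c - 1 / 2)).add ((g1.add g1').mul_left ((1 - c) / 2))).sub
      ((g2.add g2').mul_left (1 / 4))).mul_left (2 * q / (π ^ 2 * c) * (1 / 2)))
  convert! this using 1
  · ext n
    rw [show π * n / q = 2 * π * n / q / 2 by ring, sin_sq_mul_cos_add,
      show 2 * π * n * (x + 1 / q) = 2 * π * n * x + 2 * π * n / q by ring,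
      show 2 * π * n * (x - 1 / q) = 2 * π * n * x - 2 * π * n / q by ring,
      show 2 * π * n * (x + 2 / q) = 2 * π * n * x + 2 * (2 * π * n / q) by ring,
      show 2 * π * n * (x - 2 / q) = 2 * π * n * x - 2 * (2 * π * n / q) by ring]
    simp only [cos_add, cos_sub]
    split_ifs with hn
    · simp [hn]
    · ring
  · field_simp
    ring

lemma memK_extremalCoeff {ν : ℕ} (hν : 2 ≤ ν) :
    memK (2 / (2 * (ν : ℝ) + 1)) (extremalCoeff ν) := by
  have hc := cos_pi_div_pos (by omega : 1 ≤ ν)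
  have hs := hasSum_extremalCoeff (by omega : 1 ≤ ν)
  refine ⟨fun n => ?_, hs.summable, hs.tsum_eq, fun x hx hx' => ?_⟩
  · have hn : 0 ≤ cos (2 * π * n / (2 * (ν : ℝ) + 1)) + cos (π / (2 * (ν : ℝ) + 1)) := by
      linarith [neg_cos_pi_div_le_cos ν n]
    unfold extremalCoeff
    refine add_nonneg ?_ (by positivity)
    split_ifs <;> positivity
  · have h := (hasSum_extremalCoeff_mul_cos hν hx hx').tsum_eq
    rw [← h]
    refine tsum_congr fun n => ?_
    rw [← cos_abs (2 * π * n * x), abs_mul, abs_of_nonneg (by positivity : 0 ≤ 2 * π * (n : ℝ))]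

/-- Exact value of the Turán constant `A(2/q)` for odd `q = 2ν + 1 ≥ 5`. -/
theorem turanA_two_div_odd {ν : ℕ} (hν : 2 ≤ ν) : turanA (2 / (2 * (ν : ℝ) + 1)) =
    (1 + 1 / cos (π / (2 * (ν : ℝ) + 1))) / (2 * (ν : ℝ) + 1) := by
  refine IsGreatest.csSup_eq ⟨⟨_, memK_extremalCoeff hν, (extremalCoeff_zero ν).symm⟩, ?_⟩
  rintro y ⟨a, ha, rfl⟩
  exact coeff_zero_le_of_memK (by omega) ha

lemma Complex.cos_bound_six {x : ℂ} (hx : ‖x‖ ≤ 1) :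
    ‖Complex.cos x - (1 - x ^ 2 / 2 + x ^ 4 / 24)‖ ≤ ‖x‖ ^ 6 :=
  calc
    ‖Complex.cos x - (1 - x ^ 2 / 2 + x ^ 4 / 24)‖ =
        ‖(Complex.exp (-x * I) - ∑ m ∈ Finset.range 6, (-x * I) ^ m / m.factorial) / 2 +
         (Complex.exp (x * I) - ∑ m ∈ Finset.range 6, (x * I) ^ m / m.factorial) / 2‖ := by
      simp [Complex.cos, field, Finset.sum_range_succ, Nat.factorial]
      grind [I_sq, two_ne_zero]
    _ ≤ ‖Complex.exp (-x * I) - ∑ m ∈ Finset.range 6, (-x * I) ^ m / m.factorial‖ / 2 +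
        ‖Complex.exp (x * I) - ∑ m ∈ Finset.range 6, (x * I) ^ m / m.factorial‖ / 2 := by
      grw [norm_add_le]
      simp
    _ ≤ ‖-x * I‖ ^ 6 * (Nat.succ 6 * (Nat.factorial 6 * (6 : ℕ) : ℝ)⁻¹) / 2 +
        ‖x * I‖ ^ 6 * (Nat.succ 6 * (Nat.factorial 6 * (6 : ℕ) : ℝ)⁻¹) / 2 := by
      grw [exp_bound (by simpa) (by simp), exp_bound (by simpa) (by simp)]
    _ = ‖x‖ ^ 6 * (7 / 4320) := by
      norm_num [Nat.factorial]
    _ ≤ ‖x‖ ^ 6 := mul_le_of_le_one_right (by positivity) (by norm_num)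

lemma Real.cos_bound_six {x : ℝ} (hx : |x| ≤ 1) :
    |cos x - (1 - x ^ 2 / 2 + x ^ 4 / 24)| ≤ |x| ^ 6 := by
  simpa [← Complex.ofReal_cos, ← norm_eq_abs, ← Complex.norm_real] using
    Complex.cos_bound_six (x := x) (by simpa)

lemma abs_inv_cos_sub_le {x : ℝ} (hx : |x| ≤ 1) :
    |1 / cos x - (1 + x ^ 2 / 2 + 5 * x ^ 4 / 24)| ≤ 6 * x ^ 6 := by
  have h6 : |x| ^ 6 = x ^ 6 := Even.pow_abs (by decide) x
  have hb := Real.cos_bound_six hx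
  have hx2 : x ^ 2 ≤ 1 := (sq_le_one_iff_abs_le_one x).mpr hx
  have hhalf : 1 / 2 ≤ cos x := by linarith [one_sub_sq_div_two_le_cos (x := x)]
  have hc : 0 < cos x := by linarith
  set δ := cos x - (1 - x ^ 2 / 2 + x ^ 4 / 24) with hδ
  set P := 1 + x ^ 2 / 2 + 5 * x ^ 4 / 24 with hP
  have hx4 : x ^ 4 ≤ 1 := by nlinarith [sq_nonneg x]
  have hx6 : 0 ≤ x ^ 6 := by positivity
  have hP0 : 0 ≤ P := by positivity
  have hP2 : P ≤ 2 := by linarith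
  have e : 1 / cos x - P = (x ^ 6 * (1 / 12 - 5 * x ^ 2 / 576) - P * δ) / cos x := by
    rw [eq_div_iff hc.ne', sub_mul, one_div, inv_mul_cancel₀ hc.ne', hδ, hP]
    ring
  have h1 : |P * δ| ≤ 2 * x ^ 6 := by
    rw [abs_mul, abs_of_nonneg hP0]
    exact mul_le_mul hP2 (h6 ▸ hb) (abs_nonneg _) zero_le_two
  have h2 : |x ^ 6 * (1 / 12 - 5 * x ^ 2 / 576)| ≤ x ^ 6 * 1 := by
    rw [abs_mul, abs_of_nonneg hx6]
    gcongr
    rw [abs_le]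
    constructor <;> linarith [sq_nonneg x]
  rw [e, abs_div, abs_of_pos hc, div_le_iff₀ hc]
  calc _ ≤ _ := abs_sub _ _
    _ ≤ 6 * x ^ 6 * (1 / 2) := by linarith
    _ ≤ _ := by gcongr

/-- Corollary, case `h = 2/q`: as `q = 2ν+1 → ∞` through odd integers, with `h = 2/q`,
`A(h) = h + (π²/16) h³ + (5π⁴/768) h⁵ + O(h⁷)`. -/
theorem turanA_asymptotic_two_div :
    (fun ν : ℕ => turanA (2 / (2 * (ν : ℝ) + 1)) -
        (2 / (2 * (ν : ℝ) + 1) + π ^ 2 / 16 * (2 / (2 * (ν : ℝ) + 1)) ^ 3 +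
          5 * π ^ 4 / 768 * (2 / (2 * (ν : ℝ) + 1)) ^ 5)) =O[atTop]
      fun ν : ℕ => (2 / (2 * (ν : ℝ) + 1)) ^ 7 := by
  refine IsBigO.of_bound (6 * (π / 2) ^ 6 / 2) ?_
  filter_upwards [eventually_ge_atTop 2] with ν hν
  have hν' : (2 : ℝ) ≤ ν := by exact_mod_cast hν
  rw [turanA_two_div_odd hν]
  set q : ℝ := 2 * (ν : ℝ) + 1 with hq
  have hq0 : 0 < q := by positivity
  have hx : |π / q| ≤ 1 := by
    rw [abs_of_pos (by positivity), div_le_one hq0]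
    linarith [pi_le_four]
  have h := abs_inv_cos_sub_le hx
  have e : (1 + 1 / cos (π / q)) / q - (2 / q + π ^ 2 / 16 * (2 / q) ^ 3 +
      5 * π ^ 4 / 768 * (2 / q) ^ 5) =
      (1 / cos (π / q) - (1 + (π / q) ^ 2 / 2 + 5 * (π / q) ^ 4 / 24)) / q := by
    ring
  rw [e, norm_of_nonneg (by positivity : (0 : ℝ) ≤ (2 / q) ^ 7), norm_eq_abs, abs_div,
    abs_of_pos hq0, show 6 * (π / 2) ^ 6 / 2 * (2 / q) ^ 7 = 6 * (π / q) ^ 6 / q by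
      field_simp]
  gcongr
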